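/- Let D be a combinatorial arc datum satisfying [NMD], equipped with a parity function. For α ∈ H, let E_α be the unique ℂ-linear derivation of Gtl(D) with E_α(1_a) = 0 for all a ∈ 𝒜 and E_α(β) = δ_{α,β}·α for all β ∈ H (it exists because the defining ideal of Gtl(D) is spanned by paths). Then every ℂ-linear map d : Gtl(D) → Gtl(D), homogeneous of parity ε, which satisfies d(1_a) = 0 for all a ∈ 𝒜 and the graded Leibniz rule d(x·y) = d(x)·y + (−1)^{ε·|x|} x·d(y) for homogeneous x, can be written as d = Σ_{α ∈ H} z_α·E_α + [u, −] for some central elements z_α ∈ Z(Gtl(D)) and some element u ∈ Gtl(D), where [u, y] := u·y − (−1)^{|u||y|} y·u denotes the graded commutator (defined on homogeneous u, y and extended bilinearly). -/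

import Mathlib

open scoped Classical

/-- A combinatorial arc datum encoding an arc collection splitting a closed
oriented marked surface. -/
structure ArcDatum where
  /-- the set of arcs -/
  A : Type
  /-- the set of angle arrows -/
  H : Type
  [fintypeA : Fintype A]
  [fintypeH : Fintype H]
  [decEqA : DecidableEq A]
  [decEqH : DecidableEq H]
  /-- head of an angle arrow -/
  hd : H → A
  /-- tail of an angle arrow -/
  tl : H → A
  /-- the face permutation -/
  σF : Equiv.Perm H
  /-- the marked point permutation -/
  σM : Equiv.Perm H
  tl_σF : ∀ α, tl (σF α) = hd α
  tl_σM : ∀ α, tl (σM α) = hd α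
  σF_ne_σM : ∀ α, σF α ≠ σM α
  out_mem : ∀ α β, tl β = hd α → β = σF α ∨ β = σM α
  two_in : ∀ a, Fintype.card {e : H // hd e = a} = 2
  two_out : ∀ a, Fintype.card {e : H // tl e = a} = 2
  connected : ∀ a b : A,
    Relation.ReflTransGen (fun x y => ∃ e, (tl e = x ∧ hd e = y) ∨ (tl e = y ∧ hd e = x)) a b

attribute [instance] ArcDatum.fintypeA ArcDatum.fintypeH ArcDatum.decEqA ArcDatum.decEqH

namespace ArcDatum

/-- Generators of the path algebra: one idempotent per arc, one generator
per angle arrow. -/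
inductive Gen (D : ArcDatum) : Type
  | vertex : D.A → Gen D
  | arrow : D.H → Gen D

/-- The defining relations of the gentle algebra, presented as a quotient of the
free algebra on the vertex idempotents and the angle arrows: the standard path
algebra relations together with the gentle relations `σF α * α = 0`. -/
inductive GtlRel (D : ArcDatum) : FreeAlgebra ℂ (Gen D) → FreeAlgebra ℂ (Gen D) → Prop
  | vertex_mul (a b : D.A) :
      GtlRel D (FreeAlgebra.ι ℂ (Gen.vertex a) * FreeAlgebra.ι ℂ (Gen.vertex b))
        (if a = b then FreeAlgebra.ι ℂ (Gen.vertex a) else 0)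
  | vertex_sum :
      GtlRel D (∑ a : D.A, FreeAlgebra.ι ℂ (Gen.vertex a)) 1
  | head_mul (α : D.H) :
      GtlRel D (FreeAlgebra.ι ℂ (Gen.vertex (D.hd α)) * FreeAlgebra.ι ℂ (Gen.arrow α))
        (FreeAlgebra.ι ℂ (Gen.arrow α))
  | mul_tail (α : D.H) :
      GtlRel D (FreeAlgebra.ι ℂ (Gen.arrow α) * FreeAlgebra.ι ℂ (Gen.vertex (D.tl α)))
        (FreeAlgebra.ι ℂ (Gen.arrow α))
  | gentle (α : D.H) :
      GtlRel D (FreeAlgebra.ι ℂ (Gen.arrow (D.σF α)) * FreeAlgebra.ι ℂ (Gen.arrow α)) 0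

/-- The gentle algebra `Gtl(D)` of the arc datum `D`. -/
abbrev Gtl (D : ArcDatum) : Type := RingQuot (GtlRel D)

variable (D : ArcDatum)

/-- Image in the gentle algebra of the length zero path `1_a` at an arc `a`. -/
noncomputable def vtx (a : D.A) : D.Gtl :=
  RingQuot.mkAlgHom ℂ (GtlRel D) (FreeAlgebra.ι ℂ (Gen.vertex a))

/-- Image in the gentle algebra of an angle arrow. -/
noncomputable def arr (α : D.H) : D.Gtl :=
  RingQuot.mkAlgHom ℂ (GtlRel D) (FreeAlgebra.ι ℂ (Gen.arrow α))

/-- A list `[β_k, …, β_1]` of angle arrows is composable when it is a path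
`β_k ⋯ β_1` of the quiver, i.e. `t (β_{i+1}) = h (β_i)`. -/
def Composable (l : List D.H) : Prop := l.Chain' fun x y => D.tl x = D.hd y

/-- Image in the gentle algebra of the path `β_k ⋯ β_1` given by a composable
list `[β_k, …, β_1]`. -/
noncomputable def pathProd (l : List D.H) : D.Gtl := (l.map D.arr).prod

/-- The setoid on angle arrows whose classes are the marked points. -/
def mSetoid : Setoid D.H :=
  ⟨fun x y => D.σM.SameCycle x y,
    ⟨fun _ => Equiv.Perm.SameCycle.refl _ _, fun h => h.symm, fun h h' => h.trans h'⟩⟩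

/-- The setoid on angle arrows whose classes are the faces. -/
def fSetoid : Setoid D.H :=
  ⟨fun x y => D.σF.SameCycle x y,
    ⟨fun _ => Equiv.Perm.SameCycle.refl _ _, fun h => h.symm, fun h h' => h.trans h'⟩⟩

/-- The set of marked points: orbits of `σM`. -/
def MarkedPt : Type := Quotient D.mSetoid

/-- The set of faces: orbits of `σF`. -/
def Face : Type := Quotient D.fSetoid

noncomputable instance : Fintype D.MarkedPt :=
  @Quotient.fintype _ _ D.mSetoid (Classical.decRel _)

noncomputable instance : Fintype D.Face :=
  @Quotient.fintype _ _ D.fSetoid (Classical.decRel _)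

/-- The marked point `m(α)` around which the angle arrow `α` turns. -/
def mCls (α : D.H) : D.MarkedPt := @Quotient.mk _ D.mSetoid α

/-- The face `f(α)` in which the angle arrow `α` lies. -/
def faceCls (α : D.H) : D.Face := @Quotient.mk _ D.fSetoid α

/-- The `σM`-orbit of an angle arrow, as a finset. -/
noncomputable def mOrbitFinset (α : D.H) : Finset D.H :=
  Set.Finite.toFinset (Set.toFinite {β | D.σM.SameCycle α β})

/-- The `σF`-orbit of an angle arrow, as a finset. -/
noncomputable def fOrbitFinset (α : D.H) : Finset D.H :=
  Set.Finite.toFinset (Set.toFinite {β | D.σF.SameCycle α β})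

/-- The number of angle arrows around the marked point of `α`. -/
noncomputable def mCard (α : D.H) : ℕ := (D.mOrbitFinset α).card

/-- The list `[σM^(n-1) α, …, σM α, α]`, i.e. the path `σM^(n-1)(α) ⋯ σM(α) · α`. -/
noncomputable def turnList (α : D.H) (n : ℕ) : List D.H :=
  ((List.range n).map fun i => (D.σM ^ i) α).reverse

/-- The full turn starting at the angle arrow `α`: the image in the gentle
algebra of the path `σM^(k-1)(α) ⋯ σM(α) · α` where `k` is the size of the
`σM`-orbit of `α`. -/
noncomputable def fullTurn (α : D.H) : D.Gtl := D.pathProd (D.turnList α (D.mCard α))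

/-- The central element `ℓ_{m(α)}`: the sum of the full turns at the angle
arrows around the marked point of `α`. -/
noncomputable def ellArr (α : D.H) : D.Gtl := ∑ β ∈ D.mOrbitFinset α, D.fullTurn β

/-- The central element `ℓ_m` attached to a marked point `m`. -/
noncomputable def ell (m : D.MarkedPt) : D.Gtl := D.ellArr m.out

/-- The no monogons or digons condition: every face has at least 3 angles. -/
def NMD : Prop := ∀ α : D.H, 3 ≤ (D.fOrbitFinset α).card

/-- The set of endpoints of an arc: the marked points of the two angle arrows
with head `a`. -/
def endpoints (a : D.A) : Set D.MarkedPt := {m | ∃ α, D.hd α = a ∧ D.mCls α = m}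

/-- The no loops or two-cycles condition: every arc has two distinct endpoints
and two distinct arcs share at most one endpoint. -/
def NL2 : Prop :=
  (∀ (a : D.A) (α β : D.H), D.hd α = a → D.hd β = a → α ≠ β → D.mCls α ≠ D.mCls β) ∧
  ∀ a b : D.A, a ≠ b → (D.endpoints a ∩ D.endpoints b).Subsingleton

end ArcDatum

namespace ArcDatum

variable (D : ArcDatum)

/-- The parity of a path, given a parity function on the angle arrows. -/
def listPar (par : D.H → ZMod 2) (l : List D.H) : ZMod 2 := (l.map par).sum

/-- The `ℤ/2ℤ`-homogeneous component of parity `ε` of the gentle algebra: the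
span of the images of the paths of parity `ε` (length-zero paths have parity
`0`). -/
noncomputable def homog (par : D.H → ZMod 2) (ε : ZMod 2) : Submodule ℂ D.Gtl :=
  Submodule.span ℂ
    {x : D.Gtl | (ε = 0 ∧ ∃ a : D.A, x = D.vtx a) ∨
      ∃ l : List D.H, l ≠ [] ∧ D.Composable l ∧ D.listPar par l = ε ∧ x = D.pathProd l}

/-- `E` is the Euler derivation `E_α = α ∂_α`: the unique `ℂ`-linear derivation
of the gentle algebra with `E (1_a) = 0` and `E β = δ_{α,β} · α` on arrows. -/
def IsEulerDeriv (α : D.H) (E : D.Gtl →ₗ[ℂ] D.Gtl) : Prop :=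
  (∀ x y : D.Gtl, E (x * y) = E x * y + x * E y) ∧
  (∀ a : D.A, E (D.vtx a) = 0) ∧
  ∀ β : D.H, E (D.arr β) = if β = α then D.arr α else 0

end ArcDatum

namespace ArcDatum

variable (D : ArcDatum)

/-- Iterates of `σM`. -/
def it (γ : D.H) : ℕ → D.H
  | 0 => γ
  | n + 1 => D.σM (it γ n)

theorem it_succ' (γ : D.H) (n : ℕ) : D.it (D.σM γ) n = D.it γ (n + 1) := by
  induction n with
  | zero => rfl
  | succ n ih => change D.σM _ = D.σM _; rw [ih]

theorem tl_it_succ (γ : D.H) (n : ℕ) : D.tl (D.it γ (n + 1)) = D.hd (D.it γ n) :=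
  D.tl_σM _

/-- Coefficient space. -/
abbrev W : Type := D.H → ℕ → ℂ

/-- action of a vertex -/
noncomputable def actV (a : D.A) : Module.End ℂ D.W where
  toFun f γ n := if D.tl (D.it γ n) = a then f γ n else 0
  map_add' f g := by
    funext γ n; simp only [Pi.add_apply]; split_ifs <;> simp
  map_smul' c f := by
    funext γ n; simp only [Pi.smul_apply, RingHom.id_apply]; split_ifs <;> simp

/-- action of an arrow -/
noncomputable def actH (β : D.H) : Module.End ℂ D.W where
  toFun f γ n := match n with
    | 0 => 0
    | n + 1 => if D.it γ n = β then f γ n else 0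
  map_add' f g := by
    funext γ n; cases n <;> simp only [Pi.add_apply]
    · simp
    · split_ifs <;> simp
  map_smul' c f := by
    funext γ n; cases n <;> simp only [Pi.smul_apply, RingHom.id_apply]
    · simp
    · split_ifs <;> simp

/-- right action of a vertex -/
noncomputable def ractV (a : D.A) : Module.End ℂ D.W where
  toFun f γ n := if D.tl γ = a then f γ n else 0
  map_add' f g := by
    funext γ n; simp only [Pi.add_apply]; split_ifs <;> simp
  map_smul' c f := by
    funext γ n; simp only [Pi.smul_apply, RingHom.id_apply]; split_ifs <;> simp

/-- right action of an arrow -/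
noncomputable def ractH (β : D.H) : Module.End ℂ D.W where
  toFun f γ n := match n with
    | 0 => 0
    | n + 1 => if γ = β then f (D.σM β) n else 0
  map_add' f g := by
    funext γ n; cases n <;> simp only [Pi.add_apply]
    · simp
    · split_ifs <;> simp
  map_smul' c f := by
    funext γ n; cases n <;> simp only [Pi.smul_apply, RingHom.id_apply]
    · simp
    · split_ifs <;> simp

theorem actV_apply (a : D.A) (f : D.W) (γ : D.H) (n : ℕ) :
    D.actV a f γ n = if D.tl (D.it γ n) = a then f γ n else 0 := rfl
theorem actH_zero (β : D.H) (f : D.W) (γ : D.H) : D.actH β f γ 0 = 0 := rfl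
theorem actH_succ (β : D.H) (f : D.W) (γ : D.H) (n : ℕ) :
    D.actH β f γ (n + 1) = if D.it γ n = β then f γ n else 0 := rfl
theorem ractV_apply (a : D.A) (f : D.W) (γ : D.H) (n : ℕ) :
    D.ractV a f γ n = if D.tl γ = a then f γ n else 0 := rfl
theorem ractH_zero (β : D.H) (f : D.W) (γ : D.H) : D.ractH β f γ 0 = 0 := rfl
theorem ractH_succ (β : D.H) (f : D.W) (γ : D.H) (n : ℕ) :
    D.ractH β f γ (n + 1) = if γ = β then f (D.σM β) n else 0 := rfl

/-- action of the generators -/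
noncomputable def actG : Gen D → Module.End ℂ D.W
  | Gen.vertex a => D.actV a
  | Gen.arrow β => D.actH β

theorem act_rel (x y : FreeAlgebra ℂ (Gen D)) (h : GtlRel D x y) :
    FreeAlgebra.lift ℂ D.actG x = FreeAlgebra.lift ℂ D.actG y := by
  cases h with
  | vertex_mul a b =>
    apply LinearMap.ext; intro f; funext γ n
    by_cases hab : a = b
    · subst hab
      simp only [map_mul, FreeAlgebra.lift_ι_apply, actG, Module.End.mul_apply, actV_apply,
        if_true]
      split_ifs <;> rfl
    · simp only [map_mul, FreeAlgebra.lift_ι_apply, actG, Module.End.mul_apply, actV_apply, hab,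
        if_false, map_zero, LinearMap.zero_apply, Pi.zero_apply]
      split_ifs <;> simp_all
  | vertex_sum =>
    apply LinearMap.ext; intro f; funext γ n
    simp [actG, actV_apply, LinearMap.sum_apply, Finset.sum_apply]
  | head_mul α =>
    apply LinearMap.ext; intro f; funext γ n
    cases n with
    | zero => simp [actG, actV_apply, actH_zero]
    | succ n =>
      simp only [map_mul, FreeAlgebra.lift_ι_apply, actG, Module.End.mul_apply, actV_apply,
        actH_succ, tl_it_succ]
      split_ifs <;> simp_all
  | mul_tail α =>
    apply LinearMap.ext; intro f; funext γ n
    cases n with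
    | zero => simp [actG, actH_zero]
    | succ n =>
      simp only [map_mul, FreeAlgebra.lift_ι_apply, actG, Module.End.mul_apply, actV_apply,
        actH_succ]
      split_ifs <;> simp_all
  | gentle α =>
    apply LinearMap.ext; intro f; funext γ n
    rcases n with _ | _ | n
    · simp [actG, actH_zero]
    · simp [actG, actH_zero, actH_succ]
    · simp only [map_mul, FreeAlgebra.lift_ι_apply, actG, Module.End.mul_apply, 
        actH_succ, map_zero, LinearMap.zero_apply, Pi.zero_apply]
      split_ifs with h1 h2
      · exfalso
        rw [← h2] at h1
        exact D.σF_ne_σM _ h1.symm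
      · rfl
      · rfl

/-- the representation -/
noncomputable def rep : D.Gtl →ₐ[ℂ] Module.End ℂ D.W :=
  RingQuot.liftAlgHom ℂ ⟨FreeAlgebra.lift ℂ D.actG, fun x y h => D.act_rel x y h⟩

theorem rep_vtx (a : D.A) : D.rep (D.vtx a) = D.actV a := by
  simp [rep, vtx, actG]

theorem rep_arr (β : D.H) : D.rep (D.arr β) = D.actH β := by
  simp [rep, arr, actG]

theorem gen_top (T : Subalgebra ℂ D.Gtl) (h1 : ∀ a, D.vtx a ∈ T) (h2 : ∀ β, D.arr β ∈ T)
    (x : D.Gtl) : x ∈ T := by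
  obtain ⟨y, rfl⟩ := RingQuot.mkAlgHom_surjective ℂ (GtlRel D) x
  induction y using FreeAlgebra.induction with
  | grade0 r => rw [AlgHom.commutes]; exact T.algebraMap_mem r
  | grade1 g =>
    cases g with
    | vertex a => exact h1 a
    | arrow β => exact h2 β
  | mul a b ha hb => rw [map_mul]; exact T.mul_mem ha hb
  | add a b ha hb => rw [map_add]; exact T.add_mem ha hb

/-- the unit vector -/
noncomputable def oneW : D.W := fun _ n => if n = 0 then 1 else 0

/-- coefficient of the path of length `n` starting at `γ` -/
noncomputable def K (γ : D.H) (n : ℕ) : D.Gtl →ₗ[ℂ] ℂ where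
  toFun x := D.rep x D.oneW γ n
  map_add' x y := by simp
  map_smul' c x := by simp

theorem K_def (γ : D.H) (n : ℕ) (x : D.Gtl) : D.K γ n x = D.rep x D.oneW γ n := rfl

theorem K_one (γ : D.H) (n : ℕ) : D.K γ n 1 = if n = 0 then 1 else 0 := by
  simp [K_def, oneW]

theorem K_arr_mul_zero (β γ : D.H) (x : D.Gtl) : D.K γ 0 (D.arr β * x) = 0 := by
  simp [K_def, rep_arr, actH_zero]

theorem K_arr_mul (β γ : D.H) (n : ℕ) (x : D.Gtl) :
    D.K γ (n + 1) (D.arr β * x) = if D.it γ n = β then D.K γ n x else 0 := by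
  simp [K_def, rep_arr, actH_succ]

theorem K_vtx_mul (a : D.A) (γ : D.H) (n : ℕ) (x : D.Gtl) :
    D.K γ n (D.vtx a * x) = if D.tl (D.it γ n) = a then D.K γ n x else 0 := by
  simp [K_def, rep_vtx, actV_apply]

theorem comm_of_gen (R : Module.End ℂ D.W) (h1 : ∀ a, D.actV a * R = R * D.actV a)
    (h2 : ∀ β, D.actH β * R = R * D.actH β) (x : D.Gtl) : D.rep x * R = R * D.rep x := by
  have := D.gen_top ((Subalgebra.centralizer ℂ {R}).comap D.rep) (by
    intro a
    simp only [Subalgebra.mem_comap, Subalgebra.mem_centralizer_iff, Set.mem_singleton_iff,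
      forall_eq, rep_vtx]
    exact (h1 a).symm) (by
    intro a
    simp only [Subalgebra.mem_comap, Subalgebra.mem_centralizer_iff, Set.mem_singleton_iff,
      forall_eq, rep_arr]
    exact (h2 a).symm) x
  simp only [Subalgebra.mem_comap, Subalgebra.mem_centralizer_iff, Set.mem_singleton_iff,
      forall_eq] at this
  exact this.symm

theorem ractH_comm (β : D.H) (x : D.Gtl) : D.rep x * D.ractH β = D.ractH β * D.rep x := by
  apply D.comm_of_gen
  · intro a
    apply LinearMap.ext; intro f; funext γ n
    cases n with
    | zero => simp [actV_apply, ractH_zero]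
    | succ n =>
      simp only [Module.End.mul_apply, actV_apply, ractH_succ]
      by_cases h : γ = β
      · subst h; simp [it_succ']
      · simp [h]
  · intro b
    apply LinearMap.ext; intro f; funext γ n
    rcases n with _ | _ | n
    · simp [actH_zero, ractH_zero]
    · simp [actH_zero, actH_succ, ractH_zero, ractH_succ]
    · simp only [Module.End.mul_apply, actH_succ, ractH_succ]
      by_cases h : γ = β
      · subst h; simp [it_succ']
      · simp [h]

theorem ractV_comm (a : D.A) (x : D.Gtl) : D.rep x * D.ractV a = D.ractV a * D.rep x := by
  apply D.comm_of_gen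
  · intro b
    apply LinearMap.ext; intro f; funext γ n
    simp only [Module.End.mul_apply, actV_apply, ractV_apply]
    split_ifs <;> rfl
  · intro b
    apply LinearMap.ext; intro f; funext γ n
    cases n with
    | zero => simp [actH_zero, ractV_apply]
    | succ n =>
      simp only [Module.End.mul_apply, actH_succ, ractV_apply]
      split_ifs <;> rfl

theorem K_mul_arr_zero (β γ : D.H) (x : D.Gtl) : D.K γ 0 (x * D.arr β) = 0 := by
  have h1 : D.actH β D.oneW = D.ractH β D.oneW := by
    funext δ m
    cases m with
    | zero => rfl
    | succ m => cases m <;> simp [actH_succ, ractH_succ, oneW, it]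
  have h2 := congrArg (fun T => T D.oneW) (D.ractH_comm β x)
  simp only [Module.End.mul_apply] at h2
  simp only [K_def, map_mul, Module.End.mul_apply, rep_arr, h1, h2, ractH_zero]

theorem K_mul_arr (β γ : D.H) (n : ℕ) (x : D.Gtl) :
    D.K γ (n + 1) (x * D.arr β) = if γ = β then D.K (D.σM β) n x else 0 := by
  have h1 : D.actH β D.oneW = D.ractH β D.oneW := by
    funext δ m
    cases m with
    | zero => rfl
    | succ m => cases m <;> simp [actH_succ, ractH_succ, oneW, it]
  have h2 := congrArg (fun T => T D.oneW) (D.ractH_comm β x)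
  simp only [Module.End.mul_apply] at h2
  simp only [K_def, map_mul, Module.End.mul_apply, rep_arr, h1, h2, ractH_succ]

theorem K_mul_vtx (a : D.A) (γ : D.H) (n : ℕ) (x : D.Gtl) :
    D.K γ n (x * D.vtx a) = if D.tl γ = a then D.K γ n x else 0 := by
  have h1 : D.actV a D.oneW = D.ractV a D.oneW := by
    funext δ m
    cases m with
    | zero => rfl
    | succ m => simp [actV_apply, ractV_apply, oneW]
  have h2 := congrArg (fun T => T D.oneW) (D.ractV_comm a x)
  simp only [Module.End.mul_apply] at h2
  simp only [K_def, map_mul, Module.End.mul_apply, rep_vtx, h1, h2, ractV_apply]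

/-- the path starting at `γ` of length `n`, as a list -/
def turn (γ : D.H) : ℕ → List D.H
  | 0 => []
  | n + 1 => D.it γ n :: turn γ n

theorem vtx_mul_vtx (a b : D.A) : D.vtx a * D.vtx b = if a = b then D.vtx a else 0 := by
  have := RingQuot.mkAlgHom_rel ℂ (GtlRel.vertex_mul (D := D) a b)
  rw [map_mul] at this
  unfold vtx
  rw [this]; split_ifs <;> simp

theorem vtx_sum : ∑ a, D.vtx a = 1 := by
  have := RingQuot.mkAlgHom_rel ℂ (GtlRel.vertex_sum (D := D))
  rw [map_sum, map_one] at this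
  exact this

theorem hd_mul (β : D.H) : D.vtx (D.hd β) * D.arr β = D.arr β := by
  have := RingQuot.mkAlgHom_rel ℂ (GtlRel.head_mul β)
  rwa [map_mul] at this

theorem mul_tl (β : D.H) : D.arr β * D.vtx (D.tl β) = D.arr β := by
  have := RingQuot.mkAlgHom_rel ℂ (GtlRel.mul_tail β)
  rwa [map_mul] at this

theorem σF_mul (β : D.H) : D.arr (D.σF β) * D.arr β = 0 := by
  have := RingQuot.mkAlgHom_rel ℂ (GtlRel.gentle β)
  rwa [map_mul, map_zero] at this

theorem vtx_mul_arr (a : D.A) (β : D.H) :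
    D.vtx a * D.arr β = if a = D.hd β then D.arr β else 0 := by
  rw [← D.hd_mul β, ← mul_assoc, vtx_mul_vtx]
  split_ifs with h
  · rw [h]
  · simp

theorem arr_mul_vtx (a : D.A) (β : D.H) :
    D.arr β * D.vtx a = if D.tl β = a then D.arr β else 0 := by
  rw [← D.mul_tl β, mul_assoc, vtx_mul_vtx]
  split_ifs with h
  · rfl
  · simp

theorem arr_mul_arr (β γ : D.H) (h : β ≠ D.σM γ) : D.arr β * D.arr γ = 0 := by
  by_cases h1 : D.tl β = D.hd γ
  · rcases D.out_mem γ β h1 with h2 | h2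
    · rw [h2, σF_mul]
    · exact absurd h2 h
  · rw [← D.hd_mul γ, ← mul_assoc, arr_mul_vtx, if_neg h1, zero_mul]

/-- the basis -/
noncomputable def bas : D.A ⊕ D.H × ℕ → D.Gtl
  | Sum.inl a => D.vtx a
  | Sum.inr p => D.pathProd (D.turn p.1 (p.2 + 1))

theorem pathProd_cons (β : D.H) (l : List D.H) :
    D.pathProd (β :: l) = D.arr β * D.pathProd l := by simp [pathProd]

theorem pathProd_nil : D.pathProd [] = 1 := by simp [pathProd]

theorem span_mul (T : Submodule ℂ D.Gtl) (x : D.Gtl)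
    (hx : x ∈ Submodule.span ℂ (Set.range D.bas)) (g : D.Gtl)
    (hg : ∀ i, g * D.bas i ∈ T) : g * x ∈ T := by
  induction hx using Submodule.span_induction with
  | mem x h => obtain ⟨i, rfl⟩ := h; exact hg i
  | zero => simp
  | add x y _ _ h1 h2 => rw [mul_add]; exact T.add_mem h1 h2
  | smul c x _ h => rw [mul_smul_comm]; exact T.smul_mem c h

theorem bas_span (x : D.Gtl) : x ∈ Submodule.span ℂ (Set.range D.bas) := by
  set S := Submodule.span ℂ (Set.range D.bas) with hS
  have hb : ∀ i, D.bas i ∈ S := fun i => Submodule.subset_span ⟨i, rfl⟩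
  let T : Subalgebra ℂ D.Gtl :=
    { carrier := {g | ∀ y ∈ S, g * y ∈ S}
      mul_mem' := by
        intro a b ha hb y hy
        rw [mul_assoc]; exact ha _ (hb _ hy)
      add_mem' := by
        intro a b ha hb y hy
        rw [add_mul]; exact S.add_mem (ha _ hy) (hb _ hy)
      algebraMap_mem' := by
        intro r y hy
        rw [← Algebra.smul_def]; exact S.smul_mem r hy }
  have h1 : ∀ a, D.vtx a ∈ T := by
    intro a y hy
    refine D.span_mul S y hy _ ?_
    rintro (b | ⟨γ, n⟩)
    · change D.vtx a * D.vtx b ∈ S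
      rw [vtx_mul_vtx]
      split_ifs
      · exact hb (Sum.inl a)
      · exact S.zero_mem
    · have := hb (Sum.inr (γ, n))
      simp only [bas, turn, pathProd_cons] at this ⊢
      rw [← mul_assoc, vtx_mul_arr]
      split_ifs
      · exact this
      · simp
  have h2 : ∀ a, D.arr a ∈ T := by
    intro a y hy
    refine D.span_mul S y hy _ ?_
    rintro (b | ⟨γ, n⟩)
    · change D.arr a * D.vtx b ∈ S
      rw [arr_mul_vtx]
      split_ifs
      · have := hb (Sum.inr (a, 0))
        simpa [bas, turn, pathProd_cons, pathProd_nil, it] using this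
      · exact S.zero_mem
    · by_cases h : a = D.σM (D.it γ n)
      · subst h
        exact hb (Sum.inr (γ, n + 1))
      · simp only [bas, turn, pathProd_cons]
        rw [← mul_assoc, arr_mul_arr _ _ _ h, zero_mul]
        exact S.zero_mem
  have h3 := D.gen_top T h1 h2 x
  have h4 : (1 : D.Gtl) ∈ S := by
    rw [← vtx_sum]
    exact S.sum_mem fun a _ => hb (Sum.inl a)
  simpa using h3 1 h4

theorem K_vtx (a : D.A) (γ : D.H) (n : ℕ) :
    D.K γ n (D.vtx a) = if n = 0 ∧ D.tl γ = a then 1 else 0 := by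
  have := D.K_mul_vtx a γ n 1
  rw [one_mul, K_one] at this
  rw [this]
  by_cases h : n = 0 <;> simp [h]

theorem K_turn (δ : D.H) (m : ℕ) (γ : D.H) (n : ℕ) (hm : m ≠ 0) :
    D.K γ n (D.pathProd (D.turn δ m)) = if n = m ∧ γ = δ then 1 else 0 := by
  induction m generalizing n with
  | zero => exact absurd rfl hm
  | succ m ih =>
    rw [turn, pathProd_cons]
    cases n with
    | zero => simp [K_arr_mul_zero]
    | succ n =>
      rw [K_arr_mul]
      by_cases h0 : m = 0
      · subst h0
        rw [turn, pathProd_nil, K_one]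
        by_cases hn : n = 0
        · subst hn; simp [it]
        · simp [hn]
      · rw [ih n h0]
        by_cases h : n = m ∧ γ = δ
        · obtain ⟨rfl, rfl⟩ := h; simp
        · have : ¬ (n + 1 = m + 1 ∧ γ = δ) := by simpa using h
          simp [h]

/-- index of a path in the basis -/
def idx (γ : D.H) : ℕ → D.A ⊕ D.H × ℕ
  | 0 => Sum.inl (D.tl γ)
  | n + 1 => Sum.inr (γ, n)

theorem K_bas (i : D.A ⊕ D.H × ℕ) (γ : D.H) (n : ℕ) :
    D.K γ n (D.bas i) = if D.idx γ n = i then 1 else 0 := by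
  rcases i with a | ⟨δ, m⟩
  · rw [bas, K_vtx]
    cases n <;> simp [idx]
  · rw [bas, K_turn _ _ _ _ _ (by simp)]
    cases n with
    | zero => simp [idx]
    | succ n => simp [idx, and_comm]

theorem exists_coeff (x : D.Gtl) : ∃ c : (D.A ⊕ D.H × ℕ) →₀ ℂ,
    x = c.sum (fun i a => a • D.bas i) ∧ ∀ γ n, D.K γ n x = c (D.idx γ n) := by
  obtain ⟨c, hc⟩ := Finsupp.mem_span_range_iff_exists_finsupp.1 (D.bas_span x)
  refine ⟨c, hc.symm, fun γ n => ?_⟩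
  rw [← hc, Finsupp.sum, map_sum]
  simp only [map_smul, K_bas, smul_eq_mul, mul_ite, mul_one, mul_zero, Finset.sum_ite_eq]
  split_ifs with h
  · rfl
  · exact (Finsupp.notMem_support_iff.1 h).symm

theorem exists_tl (a : D.A) : ∃ γ, D.tl γ = a := by
  have h := D.two_out a
  have : 0 < Fintype.card {e : D.H // D.tl e = a} := by omega
  obtain ⟨⟨e, he⟩⟩ := Fintype.card_pos_iff.1 this
  exact ⟨e, he⟩

theorem K_inj {x y : D.Gtl} (h : ∀ γ n, D.K γ n x = D.K γ n y) : x = y := by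
  rw [← sub_eq_zero]
  obtain ⟨c, h1, h2⟩ := D.exists_coeff (x - y)
  have : c = 0 := by
    ext i
    have h3 : ∃ γ n, D.idx γ n = i := by
      rcases i with a | ⟨δ, m⟩
      · obtain ⟨γ, hγ⟩ := D.exists_tl a
        exact ⟨γ, 0, by simp [idx, hγ]⟩
      · exact ⟨δ, m + 1, rfl⟩
    obtain ⟨γ, n, rfl⟩ := h3
    rw [← h2, map_sub, h, sub_self]; rfl
  rw [h1, this]; simp

theorem K_bound (x : D.Gtl) : ∃ N, ∀ γ n, N ≤ n → D.K γ n x = 0 := by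
  obtain ⟨c, h1, h2⟩ := D.exists_coeff x
  let f : D.A ⊕ D.H × ℕ → ℕ := fun i => match i with
    | Sum.inl _ => 0
    | Sum.inr p => p.2 + 1
  refine ⟨c.support.sup f + 1, fun γ n hn => ?_⟩
  rw [h2]
  by_contra h
  have h3 := Finset.le_sup (f := f) (Finsupp.mem_support_iff.2 h)
  have h4 : f (D.idx γ n) = n := by cases n <;> rfl
  omega

theorem K_zero_tl (γ δ : D.H) (h : D.tl γ = D.tl δ) (x : D.Gtl) : D.K γ 0 x = D.K δ 0 x := by
  obtain ⟨c, h1, h2⟩ := D.exists_coeff x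
  rw [h2, h2]; simp [idx, h]

theorem turn_comp (γ : D.H) (n : ℕ) : D.Composable (D.turn γ n) := by
  rcases n with _ | n
  · exact List.IsChain.nil
  · induction n with
    | zero => exact List.IsChain.singleton _
    | succ n ih =>
      unfold Composable at ih ⊢
      rw [turn, turn]
      rw [turn] at ih
      exact List.isChain_cons_cons.2 ⟨D.tl_it_succ γ n, ih⟩

/-- building an element from its coefficients -/
theorem exists_elt (U : D.H → ℕ → ℂ) (h0 : ∀ γ, U γ 0 = 0) (N : ℕ)
    (hN : ∀ γ n, N ≤ n → U γ n = 0) (par : D.H → ZMod 2) (ε : ZMod 2)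
    (hp : ∀ γ n, U γ n ≠ 0 → D.listPar par (D.turn γ n) = ε) :
    ∃ x ∈ D.homog par ε, ∀ γ n, D.K γ n x = U γ n := by
  refine ⟨∑ δ, ∑ m ∈ Finset.range N, U δ m • D.pathProd (D.turn δ m), ?_, ?_⟩
  · refine Submodule.sum_mem _ fun δ _ => Submodule.sum_mem _ fun m _ => ?_
    by_cases h : U δ m = 0
    · rw [h, zero_smul]; exact Submodule.zero_mem _
    · refine Submodule.smul_mem _ _ (Submodule.subset_span (Or.inr ⟨_, ?_, D.turn_comp δ m,
        hp _ _ h, rfl⟩))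
      cases m with
      | zero => exact absurd (h0 δ) h
      | succ m => simp [turn]
  · intro γ n
    have key : ∀ δ m, D.K γ n (U δ m • D.pathProd (D.turn δ m)) =
        if δ = γ then (if m = n then U γ n else 0) else 0 := by
      intro δ m
      by_cases hm : m = 0
      · subst hm
        rw [h0, zero_smul, map_zero]
        split_ifs with h1 h2
        · rw [← h2, h0]
        · rfl
        · rfl
      · rw [map_smul, K_turn _ _ _ _ _ hm]
        by_cases h1 : δ = γ
        · subst h1
          by_cases h2 : m = n
          · subst h2; simp
          · simp [h2, Ne.symm h2]
        · simp [h1, Ne.symm h1]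
    simp only [map_sum, key, Finset.sum_ite_irrel, Finset.sum_const_zero, Finset.sum_ite_eq',
      Finset.mem_univ, if_true, Finset.mem_range]
    split_ifs with h
    · rfl
    · exact (hN _ _ (by omega)).symm

theorem K_pathProd_par (par : D.H → ZMod 2) (l : List D.H) (γ : D.H) (n : ℕ)
    (h : D.K γ n (D.pathProd l) ≠ 0) : D.listPar par (D.turn γ n) = D.listPar par l := by
  induction l generalizing n with
  | nil =>
    rw [pathProd_nil, K_one] at h
    have : n = 0 := by by_contra h1; simp [h1] at h
    subst this; rfl
  | cons β l ih =>
    rw [pathProd_cons] at h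
    cases n with
    | zero => rw [K_arr_mul_zero] at h; exact absurd rfl h
    | succ n =>
      rw [K_arr_mul] at h
      split_ifs at h with h1
      · have := ih n h
        simp only [listPar, turn, List.map_cons, List.sum_cons] at this ⊢
        rw [this, h1]
      · exact absurd rfl h

theorem K_homog_par (par : D.H → ZMod 2) (δ : ZMod 2) (x : D.Gtl) (hx : x ∈ D.homog par δ)
    (γ : D.H) (n : ℕ) (h : D.listPar par (D.turn γ n) ≠ δ) : D.K γ n x = 0 := by
  induction hx using Submodule.span_induction with
  | mem x hx =>
    rcases hx with ⟨rfl, a, rfl⟩ | ⟨l, _, _, rfl, rfl⟩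
    · rw [K_vtx]
      by_cases hn : n = 0
      · subst hn; exact absurd rfl h
      · simp [hn]
    · by_contra h1
      exact h (D.K_pathProd_par par l γ n h1)
  | zero => simp
  | add x y _ _ h1 h2 => simp [h1, h2]
  | smul c x _ h => simp [h]

theorem arr_homog (par : D.H → ZMod 2) (β : D.H) : D.arr β ∈ D.homog par (par β) := by
  refine Submodule.subset_span (Or.inr ⟨[β], by simp, List.IsChain.singleton _, by simp [listPar],
    by simp [pathProd]⟩)

theorem vtx_homog (par : D.H → ZMod 2) (a : D.A) : D.vtx a ∈ D.homog par 0 :=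
  Submodule.subset_span (Or.inl ⟨rfl, a, rfl⟩)

theorem vtx_comm (x : D.Gtl) (h : ∀ γ n, D.K γ n x ≠ 0 → D.tl (D.it γ n) = D.tl γ) (a : D.A) :
    D.vtx a * x = x * D.vtx a := by
  apply D.K_inj
  intro γ n
  rw [K_vtx_mul, K_mul_vtx]
  by_cases h1 : D.K γ n x = 0
  · simp [h1]
  · rw [h γ n h1]

theorem central_of (x : D.Gtl) (h : ∀ γ n, D.K γ n x ≠ 0 → D.it γ n = γ)
    (h' : ∀ γ n, D.K (D.σM γ) n x = D.K γ n x) : x ∈ Subalgebra.center ℂ D.Gtl := by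
  rw [Subalgebra.mem_center_iff]
  intro b
  have := D.gen_top (Subalgebra.centralizer ℂ {x}) (by
    intro a
    rw [Subalgebra.mem_centralizer_iff]
    simp only [Set.mem_singleton_iff, forall_eq]
    exact (D.vtx_comm x (fun γ n hn => by rw [h γ n hn]) a).symm) (by
    intro β
    rw [Subalgebra.mem_centralizer_iff]
    simp only [Set.mem_singleton_iff, forall_eq]
    apply D.K_inj
    intro γ n
    cases n with
    | zero => rw [K_arr_mul_zero, K_mul_arr_zero]
    | succ n =>
      rw [K_arr_mul, K_mul_arr, h']
      by_cases h1 : D.K γ n x = 0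
      · rw [h1, ite_self]
        split_ifs with h2
        · rw [← h2, h1]
        · rfl
      · rw [h γ n h1]
        split_ifs with h2
        · rw [h2]
        · rfl) b
  rw [Subalgebra.mem_centralizer_iff] at this
  exact (this x rfl).symm

theorem σF_ne (hNMD : D.NMD) (α : D.H) : D.σF α ≠ α := by
  intro h
  have h1 := hNMD α
  have : D.fOrbitFinset α ⊆ {α} := by
    intro β hβ
    simp only [fOrbitFinset, Set.Finite.mem_toFinset, Set.mem_ofPred_eq] at hβ
    rw [Finset.mem_singleton]
    exact (hβ.eq_of_left h).symm
  have h2 := Finset.card_le_card this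
  simp at h2
  omega

end ArcDatum

namespace ArcDatum

variable (D : ArcDatum)

theorem it_σM (γ : D.H) (n : ℕ) : D.it (D.σM γ) n = D.σM (D.it γ n) := D.it_succ' γ n

theorem listPar_succ (par : D.H → ZMod 2) (γ : D.H) (n : ℕ) :
    D.listPar par (D.turn γ (n + 1)) = par (D.it γ n) + D.listPar par (D.turn γ n) := by
  simp [listPar, turn]

theorem listPar_succ' (par : D.H → ZMod 2) (γ : D.H) (n : ℕ) :
    D.listPar par (D.turn γ (n + 1)) = par γ + D.listPar par (D.turn (D.σM γ) n) := by
  induction n with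
  | zero => simp [listPar, turn, it]
  | succ n ih => rw [listPar_succ, ih, D.listPar_succ par (D.σM γ), it_succ']; ring

theorem listPar_cyc (par : D.H → ZMod 2) (γ : D.H) (n : ℕ) (h : D.it γ n = γ) :
    D.listPar par (D.turn (D.σM γ) n) = D.listPar par (D.turn γ n) := by
  have h1 := D.listPar_succ par γ n
  rw [listPar_succ', h] at h1
  exact add_left_cancel h1

/-- sign -/
noncomputable def sg (ε p : ZMod 2) : ℂ := (-1 : ℂ) ^ (ε * p).val

theorem sg_add (ε p q : ZMod 2) : sg ε (p + q) = sg ε p * sg ε q := by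
  revert ε p q
  have h : ∀ ε : ZMod 2, ε = 0 ∨ ε = 1 := by decide
  intro ε p q
  rcases h ε with rfl | rfl <;> rcases h p with rfl | rfl <;> rcases h q with rfl | rfl <;>
    simp [sg, ZMod.val_one, show (1 : ZMod 2) + 1 = 0 from rfl]

theorem sg_zero (ε : ZMod 2) : sg ε 0 = 1 := by simp [sg]
theorem sg_zero_left (p : ZMod 2) : sg 0 p = 1 := by simp [sg]
theorem sg_one : sg 1 1 = -1 := by simp [sg, ZMod.val_one]

/-- partial solution of the holonomy equation -/
noncomputable def Fx (s : D.H → ℂ) (c : D.H → ℂ) (γ : D.H) : ℕ → ℂ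
  | 0 => 0
  | m + 1 => c (D.it γ m) + s (D.it γ m) * Fx s c γ m

theorem Fx_succ' (par : D.H → ZMod 2) (ε : ZMod 2) (c : D.H → ℂ) (γ : D.H) (m : ℕ) :
    D.Fx (fun β => sg ε (par β)) c γ (m + 1) = D.Fx (fun β => sg ε (par β)) c (D.σM γ) m +
      sg ε (D.listPar par (D.turn (D.σM γ) m)) * c γ := by
  induction m with
  | zero => simp [Fx, it, turn, listPar, sg]
  | succ m ih =>
    rw [Fx, ih, listPar_succ, sg_add, Fx, it_succ']; ring

theorem Fx_zero (s : D.H → ℂ) (c : D.H → ℂ) (γ : D.H) (m : ℕ)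
    (h : ∀ k, c (D.it γ k) = 0) : D.Fx s c γ m = 0 := by
  induction m with
  | zero => rfl
  | succ m ih => rw [Fx, ih, h]; simp

theorem cyc_solution (par : D.H → ZMod 2) (ε : ZMod 2) (c : D.H → ℕ → ℂ) (N : ℕ)
    (hN : ∀ α n, N ≤ n → c α n = 0)
    (hc : ∀ α n, c α n ≠ 0 → D.listPar par (D.turn (D.σM α) n) = ε) :
    ∃ (z : D.H → D.Gtl) (V : D.H → ℕ → ℂ), (∀ α, z α ∈ Subalgebra.center ℂ D.Gtl) ∧
      (ε = 0 ∨ ∀ α, z α = 0) ∧ (∀ γ, V γ 0 = 0) ∧ (∀ γ n, N ≤ n → V γ n = 0) ∧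
      (∀ γ n, D.it γ n = γ → V γ n ≠ 0 → D.listPar par (D.turn γ n) = ε) ∧
      (∀ α n, D.it α n ≠ α → D.K (D.σM α) n (z α) = 0) ∧
      (∀ α n, D.it α n = α →
        c α n = D.K (D.σM α) n (z α) + V (D.σM α) n - sg ε (par α) * V α n) := by
  have h2 : ∀ ε : ZMod 2, ε = 0 ∨ ε = 1 := by decide
  rcases h2 ε with rfl | rfl
  · have hz : ∀ α, ∃ z : D.Gtl, ∀ γ n, D.K γ n z =
        if D.it γ n = γ ∧ (n = 0 ∨ D.σM.SameCycle α γ) then c α n else 0 := by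
      intro α
      obtain ⟨y, -, hy⟩ := D.exists_elt (fun γ n => if n ≠ 0 ∧ D.it γ n = γ ∧
        D.σM.SameCycle α γ then c α n else 0) (by simp) N (by
          intro γ n hn; simp [hN α n hn]) (fun _ => 0) 0 (by
          intro γ n _; simp [listPar])
      refine ⟨c α 0 • 1 + y, fun γ n => ?_⟩
      rw [map_add, map_smul, K_one, hy]
      by_cases h : n = 0
      · subst h; simp [it]
      · simp [h]
    choose z hz using hz
    refine ⟨z, fun _ _ => 0, ?_, Or.inl rfl, by simp, by simp, by simp, ?_, ?_⟩
    · intro α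
      apply D.central_of
      · intro γ n h
        rw [hz] at h
        by_contra h1
        simp [h1] at h
      · intro γ n
        simp only [hz, it_σM, EmbeddingLike.apply_eq_iff_eq, Equiv.Perm.sameCycle_apply_right]
    · intro α n h
      simp [hz, it_σM, h, Equiv.Perm.SameCycle.refl]
    · intro α n h
      simp [hz, it_σM, h, Equiv.Perm.SameCycle.refl]
  · refine ⟨fun _ => 0, fun γ n => D.Fx (fun β => sg 1 (par β)) (fun β => c β n) γ n / 2,
      fun _ => Subalgebra.zero_mem _, Or.inr fun _ => rfl, by simp [Fx], ?_, ?_, by simp, ?_⟩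
    · intro γ n hn
      simp only
      rw [Fx_zero _ _ _ _ _ (fun k => hN _ _ hn), zero_div]
    · intro γ n h hV
      by_contra hp
      apply hV
      simp only
      rw [Fx_zero, zero_div]
      have key : ∀ k, D.it (D.it γ k) n = D.it γ k ∧
          D.listPar par (D.turn (D.it γ k) n) = D.listPar par (D.turn γ n) := by
        intro k
        induction k with
        | zero => exact ⟨h, rfl⟩
        | succ k ih =>
          refine ⟨?_, ?_⟩
          · rw [it, it_σM, ih.1]
          · rw [it, listPar_cyc _ _ _ _ ih.1, ih.2]
      intro k
      by_contra hk
      have := hc _ _ hk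
      rw [listPar_cyc _ _ _ _ (key k).1, (key k).2] at this
      exact hp this
    · intro α n h
      have h3 := D.Fx_succ' par 1 (fun β => c β n) α n
      rw [Fx, h] at h3
      have h4 : sg 1 (D.listPar par (D.turn (D.σM α) n)) * c α n = - c α n := by
        by_cases h5 : c α n = 0
        · simp [h5]
        · rw [hc _ _ h5, sg_one]; ring
      rw [h4] at h3
      simp only [map_zero]
      linear_combination (1 / 2 : ℂ) * h3

theorem extend (par : D.H → ZMod 2) (E : D.H → (D.Gtl →ₗ[ℂ] D.Gtl))
    (hE : ∀ α : D.H, D.IsEulerDeriv α (E α))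
    (ε : ZMod 2) (d : D.Gtl →ₗ[ℂ] D.Gtl) (hvtx : ∀ a : D.A, d (D.vtx a) = 0)
    (hLeibniz : ∀ δ : ZMod 2, ∀ x ∈ D.homog par δ, ∀ y : D.Gtl,
      d (x * y) = d x * y + ((-1 : ℂ)) ^ (ε * δ).val • (x * d y))
    (z : D.H → D.Gtl) (hz : ∀ α : D.H, z α ∈ Subalgebra.center ℂ D.Gtl)
    (hz' : ε = 0 ∨ ∀ α, z α = 0) (u : D.Gtl) (hu : ∀ a, D.vtx a * u = u * D.vtx a)
    (hd : ∀ α, d (D.arr α) = z α * D.arr α + u * D.arr α - sg ε (par α) • (D.arr α * u))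
    (δ : ZMod 2) (y : D.Gtl) (hy : y ∈ D.homog par δ) :
    d y = (∑ α : D.H, z α * E α y) + (u * y - sg ε δ • (y * u)) := by
  have hE1 : ∀ α, E α 1 = 0 := by
    intro α; rw [← D.vtx_sum, map_sum]; exact Finset.sum_eq_zero fun a _ => (hE α).2.1 a
  have hd1 : d 1 = 0 := by
    rw [← D.vtx_sum, map_sum]; exact Finset.sum_eq_zero fun a _ => hvtx a
  have hpath : ∀ l : List D.H, d (D.pathProd l) = (∑ α : D.H, z α * E α (D.pathProd l)) +
      (u * D.pathProd l - sg ε (D.listPar par l) • (D.pathProd l * u)) := by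
    intro l
    induction l with
    | nil => simp [pathProd_nil, hE1, hd1, listPar, sg]
    | cons β l ih =>
      rw [pathProd_cons, hLeibniz _ _ (D.arr_homog par β), ih, hd]
      have h1 : ∑ α, z α * E α (D.arr β * D.pathProd l) =
          z β * D.arr β * D.pathProd l + D.arr β * ∑ α, z α * E α (D.pathProd l) := by
        have : ∀ α, z α * E α (D.arr β * D.pathProd l) =
            (if β = α then z β * D.arr β * D.pathProd l else 0) +
              D.arr β * (z α * E α (D.pathProd l)) := by
          intro α
          rw [(hE α).1, (hE α).2.2, mul_add]
          congr 1
          · split_ifs with h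
            · subst h; rw [mul_assoc]
            · simp
          · rw [← mul_assoc, ← mul_assoc, (Subalgebra.mem_center_iff.1 (hz α) (D.arr β))]
        rw [Finset.sum_congr rfl fun α _ => this α, Finset.sum_add_distrib, Finset.mul_sum]
        simp
      have h2 : sg ε (par β) • (D.arr β * ∑ α, z α * E α (D.pathProd l)) =
          D.arr β * ∑ α, z α * E α (D.pathProd l) := by
        rcases hz' with rfl | h
        · rw [sg_zero_left, one_smul]
        · simp [h]
      have h3 : D.listPar par (β :: l) = par β + D.listPar par l := by simp [listPar]
      rw [h1, h3, sg_add]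
      change _ + sg ε (par β) • _ = _
      rw [mul_add, smul_add, h2]
      simp only [mul_sub, sub_mul, add_mul, smul_sub, smul_mul_assoc, mul_smul_comm, mul_smul,
        mul_assoc]
      abel
  induction hy using Submodule.span_induction with
  | mem x hx =>
    rcases hx with ⟨rfl, a, rfl⟩ | ⟨l, _, _, rfl, rfl⟩
    · rw [hvtx, sg_zero, one_smul, hu, sub_self, add_zero]
      symm
      exact Finset.sum_eq_zero fun α _ => by rw [(hE α).2.1, mul_zero]
    · exact hpath l
  | zero => simp
  | add x y _ _ h1 h2 =>
    rw [map_add, h1, h2]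
    simp only [map_add, mul_add, add_mul, Finset.sum_add_distrib, smul_add]
    abel
  | smul c x _ h =>
    rw [map_smul, h]
    simp only [map_smul, mul_smul_comm, smul_mul_assoc, smul_add, smul_sub, Finset.smul_sum,
      smul_comm c]

theorem main_exists (hNMD : D.NMD) (par : D.H → ZMod 2)
    (ε : ZMod 2) (d : D.Gtl →ₗ[ℂ] D.Gtl)
    (hhom : ∀ δ : ZMod 2, ∀ x ∈ D.homog par δ, d x ∈ D.homog par (δ + ε))
    (hvtx : ∀ a : D.A, d (D.vtx a) = 0)
    (hLeibniz : ∀ δ : ZMod 2, ∀ x ∈ D.homog par δ, ∀ y : D.Gtl,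
      d (x * y) = d x * y + ((-1 : ℂ)) ^ (ε * δ).val • (x * d y)) :
    ∃ (z : D.H → D.Gtl) (u : D.Gtl), (∀ α : D.H, z α ∈ Subalgebra.center ℂ D.Gtl) ∧
      (ε = 0 ∨ ∀ α, z α = 0) ∧ u ∈ D.homog par ε ∧ (∀ a, D.vtx a * u = u * D.vtx a) ∧
      ∀ α, d (D.arr α) = z α * D.arr α + u * D.arr α - sg ε (par α) • (D.arr α * u) := by
  have hsg : ∀ p, sg ε p ≠ 0 := by intro p; simp [sg]
  -- the main relation
  have hstar : ∀ α γ n, (if γ = α then D.K (D.σM α) n (d (D.arr (D.σF α))) else 0) +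
      sg ε (par (D.σF α)) * (if D.it γ n = D.σF α then D.K γ n (d (D.arr α)) else 0) = 0 := by
    intro α γ n
    have h := hLeibniz _ _ (D.arr_homog par (D.σF α)) (D.arr α)
    rw [σF_mul, map_zero] at h
    have h2 := congrArg (D.K γ (n + 1)) h
    rw [map_zero, map_add, map_smul, K_mul_arr, K_arr_mul] at h2
    exact h2.symm
  have htl : ∀ α γ n, D.K γ n (d (D.arr α)) ≠ 0 → D.tl γ = D.tl α := by
    intro α γ n h
    have h1 := hLeibniz _ _ (D.arr_homog par α) (D.vtx (D.tl α))
    rw [mul_tl, hvtx, mul_zero, smul_zero, add_zero] at h1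
    rw [h1, K_mul_vtx] at h
    by_contra h2
    simp [h2] at h
  have hhd : ∀ α γ n, D.K γ n (d (D.arr α)) ≠ 0 → D.tl (D.it γ n) = D.hd α := by
    intro α γ n h
    have h1 := hLeibniz _ _ (D.vtx_homog par (D.hd α)) (D.arr α)
    rw [hd_mul, hvtx, zero_mul, zero_add, mul_zero] at h1
    rw [h1, map_smul, K_vtx_mul] at h
    by_contra h2
    simp [h2] at h
  have hzero : ∀ α γ, D.K γ 0 (d (D.arr α)) = 0 := by
    intro α γ
    by_contra h
    have h1 := hhd _ _ _ h
    have h2 := hstar α (D.σF α) 0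
    rw [if_neg (D.σF_ne hNMD α), if_pos (show D.it (D.σF α) 0 = D.σF α from rfl), zero_add] at h2
    have h3 := (mul_eq_zero.1 h2).resolve_left (hsg _)
    rw [D.K_zero_tl (D.σF α) γ (by rw [D.tl_σF]; exact h1.symm)] at h3
    exact h h3
  have hpar : ∀ α n, D.K α (n + 1) (d (D.arr α)) ≠ 0 →
      D.listPar par (D.turn (D.σM α) n) = ε := by
    intro α n h
    by_contra h1
    apply h
    apply D.K_homog_par par _ _ (hhom _ _ (D.arr_homog par α))
    rw [listPar_succ']
    intro h2
    exact h1 (add_left_cancel h2)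
  have hbd : ∃ N, ∀ α n, N ≤ n → D.K α (n + 1) (d (D.arr α)) = 0 := by
    choose N hN using fun α => D.K_bound (d (D.arr α))
    refine ⟨Finset.univ.sup N, fun α n hn => hN α α (n + 1) ?_⟩
    have := Finset.le_sup (f := N) (Finset.mem_univ α)
    omega
  obtain ⟨N, hN⟩ := hbd
  obtain ⟨z, V, hz, hz', hV0, hVN, hVp, hzc, hcyc⟩ := D.cyc_solution par ε
    (fun α n => D.K α (n + 1) (d (D.arr α))) N hN hpar
  obtain ⟨u, hu, huK⟩ := D.exists_elt (fun γ n => if D.it γ n = γ then V γ n else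
      D.K (D.σM.symm γ) (n + 1) (d (D.arr (D.σM.symm γ)))) (by intro γ; simp [it, hV0]) N (by
      intro γ n hn
      rw [hVN γ n hn, hN _ n hn, ite_self]) par ε (by
      intro γ n h
      split_ifs at h with h1
      · exact hVp _ _ h1 h
      · have := hpar _ _ h
        rwa [Equiv.apply_symm_apply] at this)
  refine ⟨z, u, hz, hz', hu, ?_, ?_⟩
  · apply D.vtx_comm
    intro γ n h
    rw [huK] at h
    split_ifs at h with h1
    · rw [h1]
    · have := hhd _ _ _ h
      rw [← it_succ', Equiv.apply_symm_apply] at this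
      rw [this, ← D.tl_σM, Equiv.apply_symm_apply]
  · intro α
    apply D.K_inj
    intro γ m
    cases m with
    | zero =>
      rw [hzero, map_sub, map_add, map_smul, K_mul_arr_zero, K_mul_arr_zero, K_arr_mul_zero]
      simp
    | succ n =>
      rw [map_sub, map_add, map_smul, K_mul_arr, K_mul_arr, K_arr_mul, huK, huK,
        Equiv.symm_apply_apply, smul_eq_mul, it_σM]
      simp only [EmbeddingLike.apply_eq_iff_eq]
      by_cases h1 : γ = α
      · subst h1
        by_cases h2 : D.it γ n = γ
        · simp only [if_true, if_pos h2]
          exact hcyc γ n h2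
        · simp [h2, hzc γ n h2]
      · simp only [if_neg h1]
        by_cases h2 : D.it γ n = α
        · have h3 : D.it γ n ≠ γ := by rw [h2]; exact Ne.symm h1
          rw [if_pos h2, if_neg h3]
          obtain ⟨β, rfl⟩ := D.σM.surjective γ
          rw [Equiv.symm_apply_apply]
          by_cases h4 : D.tl α = D.hd β
          · rcases D.out_mem β α h4 with h5 | h5
            · have h6 := hstar β β (n + 1)
              rw [← h5, if_pos rfl, ← it_succ', if_pos h2] at h6
              linear_combination h6
            · exact absurd h5.symm h1
          · have h5 : D.K (D.σM β) (n + 1) (d (D.arr α)) = 0 := by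
              by_contra h
              have := htl _ _ _ h
              rw [D.tl_σM] at this
              exact h4 this.symm
            have h6 : D.K β (n + 1) (d (D.arr β)) = 0 := by
              by_contra h
              have := hhd _ _ _ h
              rw [← it_succ', h2] at this
              exact h4 this
            rw [h5, h6]; ring
        · rw [if_neg h2]
          have h3 : D.K γ (n + 1) (d (D.arr α)) = 0 := by
            by_contra h
            rcases D.out_mem α _ (hhd _ _ _ h) with h4 | h4
            · have h5 := hstar α γ (n + 1)
              rw [if_neg h1, if_pos h4, zero_add] at h5
              exact h ((mul_eq_zero.1 h5).resolve_left (hsg _))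
            · exact h2 (D.σM.injective h4)
          rw [h3]; ring

end ArcDatum

open ArcDatum in
/-- Every parity-homogeneous graded `ℂ`-linear derivation `d` of `Gtl(D)`
vanishing on the vertex idempotents can be written as
`d = Σ_α z_α · E_α + [u, −]` with `z_α` central and `[u, −]` a graded
commutator (here `u = u₀ + u₁` is split into its homogeneous parts). -/
theorem outer_derivations_generated_by_euler (D : ArcDatum) (hNMD : D.NMD)
    (par : D.H → ZMod 2)
    (E : D.H → (D.Gtl →ₗ[ℂ] D.Gtl)) (hE : ∀ α : D.H, D.IsEulerDeriv α (E α))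
    (ε : ZMod 2) (d : D.Gtl →ₗ[ℂ] D.Gtl)
    (hhom : ∀ δ : ZMod 2, ∀ x ∈ D.homog par δ, d x ∈ D.homog par (δ + ε))
    (hvtx : ∀ a : D.A, d (D.vtx a) = 0)
    (hLeibniz : ∀ δ : ZMod 2, ∀ x ∈ D.homog par δ, ∀ y : D.Gtl,
      d (x * y) = d x * y + ((-1 : ℂ)) ^ (ε * δ).val • (x * d y)) :
    ∃ (z : D.H → D.Gtl) (_ : ∀ α : D.H, z α ∈ Subalgebra.center ℂ D.Gtl)
      (u₀ u₁ : D.Gtl) (_ : u₀ ∈ D.homog par 0) (_ : u₁ ∈ D.homog par 1),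
      ∀ δ : ZMod 2, ∀ y ∈ D.homog par δ,
        d y = (∑ α : D.H, z α * E α y) +
          ((u₀ + u₁) * y - y * u₀ - ((-1 : ℂ)) ^ δ.val • (y * u₁)) := by
  obtain ⟨z, u, hz, hz', hu, hc, hd⟩ := D.main_exists hNMD par ε d hhom hvtx hLeibniz
  have key := D.extend par E hE ε d hvtx hLeibniz z hz hz' u hc hd
  have h2 : ∀ ε : ZMod 2, ε = 0 ∨ ε = 1 := by decide
  rcases h2 ε with rfl | rfl
  · refine ⟨z, hz, u, 0, hu, Submodule.zero_mem _, fun δ y hy => ?_⟩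
    rw [key δ y hy, sg_zero_left]
    simp
  · refine ⟨z, hz, 0, u, Submodule.zero_mem _, hu, fun δ y hy => ?_⟩
    rw [key δ y hy, sg]
    simp
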